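/- Let X be a finite nonempty set and let E be an equivalence relation on X which is not the identity relation (there exist x ≠ y with (x,y) ∈ E). Let the E-classes be A₁, …, Aₙ and let m = |A₁|·|A₂|⋯|Aₙ|. Then the rank of the semigroup Q_{E^*}(X) — the least cardinality of a subset whose generated subsemigroup is all of Q_{E^*}(X) — equals max{2, m}. -/

import Mathlib

/-- Composition written left-to-right: `(x)(a·b) = ((x)a)b`. -/
def rcomp {X : Type*} (a b : X → X) : X → X := fun x => b (a x)

/-- The semigroup `Q_{E^*}(X)`: maps preserving `E` in both directions such that the image of
each `E`-class is a singleton and each `E`-class meets the range. -/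
def QEstar {X : Type*} (E : Setoid X) : Set (X → X) :=
  {α | (∀ x y : X, E.r x y ↔ E.r (α x) (α y)) ∧
       (∀ x y : X, E.r x y → α x = α y) ∧
       (∀ x : X, ∃ z : X, E.r x (α z))}

/-- The subsemigroup (of `X → X` under left-to-right composition) generated by `G`:
the smallest set containing `G` and closed under `rcomp`. -/
def genClosure {X : Type*} (G : Set (X → X)) : Set (X → X) :=
  ⋂₀ {T : Set (X → X) | G ⊆ T ∧ ∀ a ∈ T, ∀ b ∈ T, rcomp a b ∈ T}

/-- The symmetric group on a finite type is generated, as a monoid, by two elements. -/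
theorem exists_closure_pair_eq_top_perm (α : Type*) [Finite α] :
    ∃ a b : Equiv.Perm α, Submonoid.closure {a, b} = ⊤ := by
  classical
  have := Fintype.ofFinite α
  rcases subsingleton_or_nontrivial α with h | h
  · exact ⟨1, 1, Subsingleton.elim _ _⟩
  obtain ⟨f, hf, -⟩ := (Finset.univ : Finset α).exists_cycleOn
  rw [Finset.coe_univ] at hf
  have hc : f.IsCycle := Equiv.Perm.isCycle_iff_exists_isCycleOn.2
    ⟨Set.univ, Set.nontrivial_univ, hf, fun _ _ => Set.mem_univ _⟩
  have hs : f.support = Finset.univ := by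
    ext x
    simpa using hf.apply_ne Set.nontrivial_univ (Set.mem_univ x)
  obtain ⟨x, -⟩ := exists_pair_ne α
  refine ⟨f, Equiv.swap x (f x), ?_⟩
  rw [← Subgroup.closure_toSubmonoid_of_finite, Equiv.Perm.closure_cycle_adjacent_swap hc hs,
    Subgroup.top_toSubmonoid]

section

variable {X : Type*} {E : Setoid X}

theorem subset_genClosure (G : Set (X → X)) : G ⊆ genClosure G :=
  fun _ ha _ hT => hT.1 ha

theorem rcomp_mem_genClosure {G : Set (X → X)} {a b : X → X} (ha : a ∈ genClosure G)
    (hb : b ∈ genClosure G) : rcomp a b ∈ genClosure G :=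
  fun T hT => hT.2 a (ha T hT) b (hb T hT)

theorem genClosure_subset {G T : Set (X → X)} (hG : G ⊆ T)
    (hT : ∀ a ∈ T, ∀ b ∈ T, rcomp a b ∈ T) : genClosure G ⊆ T :=
  fun _ ha => ha T ⟨hG, hT⟩

/-- Every element of `genClosure G` ends with a factor from `G`. -/
theorem exists_eq_comp_of_mem_genClosure {G : Set (X → X)} {a : X → X}
    (ha : a ∈ genClosure G) : ∃ b ∈ G, ∃ f : X → X, a = b ∘ f := by
  refine genClosure_subset (T := {a | ∃ b ∈ G, ∃ f : X → X, a = b ∘ f})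
    (fun b hb => ⟨b, hb, id, rfl⟩) ?_ ha
  rintro a - _ ⟨b, hb, f, rfl⟩
  exact ⟨b, hb, f ∘ a, rfl⟩

/-- Transversals of an equivalence relation. -/
abbrev Transversal (E : Setoid X) : Type _ :=
  ∀ q : Quotient E, {x : X // Quotient.mk E x = q}

/-- The map sending each class `q` to the representative chosen by `t` in the class `σ q`. -/
def permTransversalMap (σ : Equiv.Perm (Quotient E)) (t : Transversal E) : X → X :=
  fun x => t (σ (Quotient.mk E x))

theorem mk_permTransversalMap (σ : Equiv.Perm (Quotient E)) (t : Transversal E) (x : X) :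
    Quotient.mk E (permTransversalMap σ t x) = σ (Quotient.mk E x) :=
  (t _).2

theorem rcomp_permTransversalMap (σ τ : Equiv.Perm (Quotient E)) (t r : Transversal E) :
    rcomp (permTransversalMap σ t) (permTransversalMap τ r) = permTransversalMap (τ * σ) r := by
  funext x
  change (r (τ (Quotient.mk E (permTransversalMap σ t x))) : X) = _
  rw [mk_permTransversalMap]
  rfl

theorem transversal_eq_of_permTransversalMap_eq_comp {σ τ : Equiv.Perm (Quotient E)}
    {t r : Transversal E} {f : X → X}
    (h : permTransversalMap σ t = permTransversalMap τ r ∘ f) : t = r := by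
  funext q
  obtain ⟨x, hx⟩ := Quotient.exists_rep (σ.symm q)
  have h1 : (t q : X) = r (τ (Quotient.mk E (f x))) := by
    have := congrFun h x
    change (t (σ (Quotient.mk E x)) : X) = _ at this
    have hq : σ (Quotient.mk E x) = q := by
      rw [show Quotient.mk E x = σ.symm q from hx, Equiv.apply_symm_apply]
    rwa [hq] at this
  have h2 : τ (Quotient.mk E (f x)) = q :=
    (r _).2.symm.trans ((congrArg (Quotient.mk E) h1.symm).trans (t q).2)
  rw [h2] at h1
  exact Subtype.ext h1

theorem permTransversalMap_mem (σ : Equiv.Perm (Quotient E)) (t : Transversal E) :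
    permTransversalMap σ t ∈ QEstar E := by
  refine ⟨fun x y => ?_, fun x y h => ?_, fun x => ?_⟩
  · rw [← Quotient.eq, ← Quotient.eq, mk_permTransversalMap, mk_permTransversalMap,
      σ.injective.eq_iff]
  · unfold permTransversalMap
    rw [Quotient.sound h]
  · obtain ⟨z, hz⟩ := Quotient.exists_rep (σ.symm (Quotient.mk E x))
    refine ⟨z, Quotient.exact ?_⟩
    rw [mk_permTransversalMap, show Quotient.mk E z = _ from hz, Equiv.apply_symm_apply]

theorem exists_eq_permTransversalMap [Finite X] {a : X → X} (ha : a ∈ QEstar E) :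
    ∃ σ t, a = permTransversalMap (E := E) σ t := by
  obtain ⟨h1, h2, h3⟩ := ha
  let s : Quotient E → Quotient E := Quotient.map a fun x y h => (h1 x y).1 h
  have hs : Function.Surjective s := by
    rintro ⟨x⟩
    obtain ⟨z, hz⟩ := h3 x
    exact ⟨Quotient.mk E z, (Quotient.sound hz).symm⟩
  let σ : Equiv.Perm (Quotient E) :=
    Equiv.ofBijective s (Finite.injective_iff_bijective.1 (Finite.injective_iff_surjective.2 hs))
  have key : ∀ q, Quotient.mk E (Quotient.lift a h2 q) = σ q := by
    rintro ⟨x⟩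
    rfl
  refine ⟨σ, fun q => ⟨Quotient.lift a h2 (σ.symm q), ?_⟩, ?_⟩
  · rw [key, Equiv.apply_symm_apply]
  · funext x
    simp only [permTransversalMap, Equiv.symm_apply_apply]
    rfl

theorem permTransversalMap_mem_genClosure [Finite X] {G : Set (X → X)}
    {g : Transversal E → Equiv.Perm (Quotient E)}
    (hG : ∀ t, permTransversalMap (g t) t ∈ G)
    (hg : Submonoid.closure (Set.range g) = ⊤) [Nonempty (Transversal E)]
    (σ : Equiv.Perm (Quotient E)) (t : Transversal E) :
    permTransversalMap σ t ∈ genClosure G := by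
  have hmem t := subset_genClosure G (hG t)
  have key : ∀ ρ τ : Equiv.Perm (Quotient E),
      (∃ r, permTransversalMap τ r ∈ genClosure G) →
      ∃ r, permTransversalMap (ρ * τ) r ∈ genClosure G := by
    intro ρ
    have hρ : ρ ∈ Submonoid.closure (Set.range g) := hg ▸ Submonoid.mem_top ρ
    induction hρ using Submonoid.closure_induction with
    | mem _ h =>
      obtain ⟨r, rfl⟩ := h
      rintro τ ⟨r', hr'⟩
      exact ⟨r, rcomp_permTransversalMap τ (g r) r' r ▸ rcomp_mem_genClosure hr' (hmem r)⟩
    | one => simp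
    | mul x y _ _ hx hy =>
      intro τ h
      rw [mul_assoc]
      exact hx _ (hy _ h)
  obtain ⟨r, hr⟩ := key ((g t)⁻¹ * σ * (g t)⁻¹) (g t) ⟨t, hmem t⟩
  have := rcomp_mem_genClosure hr (hmem t)
  rw [rcomp_permTransversalMap] at this
  simpa [mul_assoc] using this

theorem exists_ncard_eq_card_transversal [Finite X] [Nontrivial (Transversal E)] :
    ∃ G : Set (X → X), G ⊆ QEstar E ∧ genClosure G = QEstar E ∧
      G.ncard = Nat.card (Transversal E) := by
  classical
  obtain ⟨a, b, hab⟩ := exists_closure_pair_eq_top_perm (Quotient E)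
  obtain ⟨t₀, t₁, ht⟩ := exists_pair_ne (Transversal E)
  let g : Transversal E → Equiv.Perm (Quotient E) := fun t => if t = t₀ then a else b
  have hg : Submonoid.closure (Set.range g) = ⊤ := by
    refine top_le_iff.1 (hab ▸ Submonoid.closure_mono ?_)
    rintro _ (rfl | rfl)
    · exact ⟨t₀, if_pos rfl⟩
    · exact ⟨t₁, if_neg ht.symm⟩
  have hG : Set.range (fun t => permTransversalMap (g t) t) ⊆ QEstar E := by
    rintro _ ⟨t, rfl⟩
    exact permTransversalMap_mem _ _
  refine ⟨_, hG, (genClosure_subset hG ?_).antisymm fun a ha => ?_,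
    Set.ncard_range_of_injective fun t r h =>
      transversal_eq_of_permTransversalMap_eq_comp (f := id) h⟩
  · intro a ha b hb
    obtain ⟨σ, t, rfl⟩ := exists_eq_permTransversalMap ha
    obtain ⟨τ, r, rfl⟩ := exists_eq_permTransversalMap hb
    rw [rcomp_permTransversalMap]
    exact permTransversalMap_mem _ _
  · obtain ⟨σ, t, rfl⟩ := exists_eq_permTransversalMap ha
    exact permTransversalMap_mem_genClosure (g := g) (fun t => Set.mem_range_self t) hg σ t

theorem card_transversal_le_ncard [Finite X] {G : Set (X → X)} (hG : G ⊆ QEstar E)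
    (h : genClosure G = QEstar E) : Nat.card (Transversal E) ≤ G.ncard := by
  have key : ∀ t : Transversal E, ∃ σ, permTransversalMap σ t ∈ G := by
    intro t
    obtain ⟨b, hb, f, hf⟩ := exists_eq_comp_of_mem_genClosure
      (h.symm ▸ permTransversalMap_mem 1 t : permTransversalMap 1 t ∈ genClosure G)
    obtain ⟨σ, r, rfl⟩ := exists_eq_permTransversalMap (hG hb)
    exact ⟨σ, transversal_eq_of_permTransversalMap_eq_comp hf ▸ hb⟩
  choose σ hσ using key
  rw [← Nat.card_coe_set_eq]
  exact Nat.card_le_card_of_injective (fun t => (⟨_, hσ t⟩ : G)) fun t r htr =>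
    transversal_eq_of_permTransversalMap_eq_comp (f := id) (congrArg Subtype.val htr)

instance : Nonempty (Transversal E) :=
  ⟨fun q => ⟨q.out, q.out_eq⟩⟩

theorem nontrivial_transversal (hE : ∃ x y : X, x ≠ y ∧ E.r x y) :
    Nontrivial (Transversal E) := by
  classical
  obtain ⟨x, y, hne, hxy⟩ := hE
  obtain ⟨t⟩ := (inferInstance : Nonempty (Transversal E))
  refine ⟨Function.update t (Quotient.mk E x) ⟨x, rfl⟩,
    Function.update t (Quotient.mk E x) ⟨y, (Quotient.sound hxy).symm⟩, fun h => hne ?_⟩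
  simpa using congrFun h (Quotient.mk E x)

end

/-- if `X` is finite and nonempty and `E` is not the identity relation, with
`m` the product of the sizes of the `E`-classes, then the rank of `Q_{E^*}(X)` equals
`max {2, m}`. -/
theorem stmt12 {X : Type*} [Fintype X] [Nonempty X] (E : Setoid X)
    (hE : ∃ x y : X, x ≠ y ∧ E.r x y)
    [Fintype (Quotient E)]
    (m : ℕ) (hm : m = ∏ q : Quotient E, Nat.card {x : X // Quotient.mk E x = q}) :
    sInf {k : ℕ | ∃ G : Set (X → X),
        G ⊆ QEstar E ∧ genClosure G = QEstar E ∧ G.ncard = k}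
      = max 2 m := by
  have : Nontrivial (Transversal E) := nontrivial_transversal hE
  have hm' : m = Nat.card (Transversal E) := by
    rw [hm, Nat.card_pi]
  have h2 : 2 ≤ m := hm' ▸ Finite.one_lt_card
  rw [max_eq_right h2, hm']
  refine IsLeast.csInf_eq ⟨exists_ncard_eq_card_transversal, ?_⟩
  rintro k ⟨G, hG, h, rfl⟩
  exact card_transversal_le_ncard hG h
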